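/- (Key integrability estimate in the proof of the Strichartz estimates.) Let μ > 0 with μ ≠ 1/4 and let d ≥ 1. Then there exists C > 0, independent of t₀ and of the data, such that for all t₀ ≥ 0 and all measurable g₀, g₁ : ℝ^d → ℂ with ‖g₀‖_{L²} + ‖g₁‖_{L²} < ∞, one has ∫_{t₀}^{∞} (1+s)^{−2} ‖ E_0(s,t₀,·) g₀ + E_1(s,t₀,·) g₁ ‖_{L²} ds ≤ C (‖g₀‖_{L²} + ‖g₁‖_{L²}). -/

import Mathlib

open MeasureTheory Real Set

noncomputable section

/-- Bessel function of the first kind `J_ν(τ)`, defined by its power series,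
using the principal branch of `(τ/2)^(ν+2k)`. -/
def besselJ (ν : ℂ) (τ : ℝ) : ℂ :=
  ∑' k : ℕ, ((-1 : ℂ) ^ k / ((Nat.factorial k : ℂ) * Complex.Gamma (ν + k + 1))) *
    ((τ : ℂ) / 2) ^ (ν + 2 * (k : ℂ))

/-- Bessel function of the second kind (Neumann function) `Y_ν(τ)` for `ν ∉ ℤ`. -/
def besselY (ν : ℂ) (τ : ℝ) : ℂ :=
  (besselJ ν τ * Complex.cos (ν * (π : ℂ)) - besselJ (-ν) τ) / Complex.sin (ν * (π : ℂ))

/-- The index `ν` associated with the mass parameter `μ`. -/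
def nuOf (μ : ℝ) : ℂ :=
  if μ ≤ 1 / 4 then ((Real.sqrt (1 - 4 * μ) / 2 : ℝ) : ℂ)
  else Complex.I * ((Real.sqrt (4 * μ - 1) / 2 : ℝ) : ℂ)

/-- `e₊(t,ξ) = τ^{1/2} J_ν(τ)` with `τ = (1+t) r`, `r = |ξ|`. -/
def ePlus (ν : ℂ) (r t : ℝ) : ℂ :=
  (Real.sqrt ((1 + t) * r) : ℂ) * besselJ ν ((1 + t) * r)

/-- `e₋(t,ξ) = τ^{1/2} Y_ν(τ)` with `τ = (1+t) r`, `r = |ξ|`. -/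
def eMinus (ν : ℂ) (r t : ℝ) : ℂ :=
  (Real.sqrt ((1 + t) * r) : ℂ) * besselY ν ((1 + t) * r)

/-- `ė₊ = ∂ₜ e₊`. -/
def ePlusDot (ν : ℂ) (r t : ℝ) : ℂ := deriv (ePlus ν r) t

/-- `ė₋ = ∂ₜ e₋`. -/
def eMinusDot (ν : ℂ) (r t : ℝ) : ℂ := deriv (eMinus ν r) t

/-- The Fourier multiplier `E₀(t,t₀,ξ)` of the Klein–Gordon propagator. -/
def E0 (ν : ℂ) (r t t₀ : ℝ) : ℂ :=
  (ePlus ν r t * eMinusDot ν r t₀ - ePlusDot ν r t₀ * eMinus ν r t) /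
    (ePlus ν r t₀ * eMinusDot ν r t₀ - ePlusDot ν r t₀ * eMinus ν r t₀)

/-- The Fourier multiplier `E₁(t,t₀,ξ)` of the Klein–Gordon propagator. -/
def E1 (ν : ℂ) (r t t₀ : ℝ) : ℂ :=
  (ePlus ν r t₀ * eMinus ν r t - ePlus ν r t * eMinus ν r t₀) /
    (ePlus ν r t₀ * eMinusDot ν r t₀ - ePlusDot ν r t₀ * eMinus ν r t₀)

/-- `Ė₀ = ∂ₜ E₀` (derivative in the first time variable). -/
def E0dot (ν : ℂ) (r t t₀ : ℝ) : ℂ := deriv (fun s => E0 ν r s t₀) t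

/-- `Ė₁ = ∂ₜ E₁` (derivative in the first time variable). -/
def E1dot (ν : ℂ) (r t t₀ : ℝ) : ℂ := deriv (fun s => E1 ν r s t₀) t

/-- The Neumann function `Y₀(τ)` (logarithmic case `ν = 0`). -/
def besselY0 (τ : ℝ) : ℂ :=
  (2 / (π : ℂ)) * (Complex.log ((τ : ℂ) / 2) + (Real.eulerMascheroniConstant : ℂ)) * besselJ 0 τ +
    (2 / (π : ℂ)) * ∑' k : ℕ,
      ((-1 : ℂ) ^ ((k + 1) + 1) * ((harmonic (k + 1) : ℚ) : ℂ) /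
          ((Nat.factorial (k + 1) : ℂ)) ^ 2) * ((τ : ℂ) / 2) ^ (2 * (k + 1))

/-- `e₋(t,ξ) = τ^{1/2} Y₀(τ)` in the case `μ = 1/4`, `ν = 0`. -/
def eMinusZ (r t : ℝ) : ℂ :=
  (Real.sqrt ((1 + t) * r) : ℂ) * besselY0 ((1 + t) * r)

/-- `ė₋ = ∂ₜ e₋` in the case `μ = 1/4`. -/
def eMinusZDot (r t : ℝ) : ℂ := deriv (eMinusZ r) t

/-- `E₀(t,t₀,ξ)` in the case `μ = 1/4`, `ν = 0`. -/
def E0Z (r t t₀ : ℝ) : ℂ :=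
  (ePlus 0 r t * eMinusZDot r t₀ - ePlusDot 0 r t₀ * eMinusZ r t) /
    (ePlus 0 r t₀ * eMinusZDot r t₀ - ePlusDot 0 r t₀ * eMinusZ r t₀)

/-- `E₁(t,t₀,ξ)` in the case `μ = 1/4`, `ν = 0`. -/
def E1Z (r t t₀ : ℝ) : ℂ :=
  (ePlus 0 r t₀ * eMinusZ r t - ePlus 0 r t * eMinusZ r t₀) /
    (ePlus 0 r t₀ * eMinusZDot r t₀ - ePlusDot 0 r t₀ * eMinusZ r t₀)

/-- `Ė₀` in the case `μ = 1/4`. -/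
def E0Zdot (r t t₀ : ℝ) : ℂ := deriv (fun s => E0Z r s t₀) t

/-- `Ė₁` in the case `μ = 1/4`. -/
def E1Zdot (r t t₀ : ℝ) : ℂ := deriv (fun s => E1Z r s t₀) t


/-- Termwise differentiation of an everywhere convergent power series. -/
theorem hasDerivAt_tsum_pow {a : ℕ → ℂ} (ha : ∀ R : ℝ, Summable fun k => ‖a k‖ * R ^ k) (z : ℂ) :
    HasDerivAt (fun w => ∑' k, a k * w ^ k) (∑' k : ℕ, ((k : ℂ) + 1) * a (k + 1) * z ^ k) z := by
  set R : ℝ := ‖z‖ + 1 with hR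
  have hR1 : 1 ≤ R := by simp [hR]
  have hbound : ∀ (k : ℕ) (y : ℂ), y ∈ Metric.ball (0 : ℂ) R →
      ‖a k * ((k : ℂ) * y ^ (k - 1))‖ ≤ ‖a k‖ * (2 * R) ^ k := by
    intro k y hy
    have hy' : ‖y‖ ≤ R := by simpa using (mem_ball_zero_iff.mp hy).le
    rw [norm_mul, norm_mul, norm_pow, mul_pow, Complex.norm_natCast]
    gcongr
    · exact_mod_cast (Nat.lt_two_pow_self (n := k)).le
    · exact (pow_le_pow_left₀ (norm_nonneg y) hy' _).trans
        (pow_le_pow_right₀ hR1 (Nat.sub_le k 1))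
  have hz : z ∈ Metric.ball (0 : ℂ) R := by simp [hR]
  have hsum0 : Summable fun k => a k * z ^ k := by
    refine Summable.of_norm ?_
    simpa using ha ‖z‖
  have h := hasDerivAt_tsum_of_isPreconnected (ha (2 * R)) Metric.isOpen_ball
    (convex_ball (0 : ℂ) R).isPreconnected
    (g := fun k w => a k * w ^ k) (g' := fun k w => a k * ((k : ℂ) * w ^ (k - 1)))
    (fun k y _ => (hasDerivAt_pow k y).const_mul (a k)) hbound hz hsum0 hz
  have hs : Summable fun k => a k * ((k : ℂ) * z ^ (k - 1)) :=
    Summable.of_norm_bounded (ha (2 * R)) (fun k => hbound k z hz)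
  refine h.congr_deriv ?_
  rw [hs.tsum_eq_zero_add]
  simp only [Nat.cast_zero, zero_mul, mul_zero, zero_add, Nat.add_sub_cancel]
  refine tsum_congr fun k => ?_
  push_cast
  ring

theorem summable_norm_deriv_coeff {a : ℕ → ℂ} (ha : ∀ R : ℝ, Summable fun k => ‖a k‖ * R ^ k)
    (R : ℝ) : Summable fun k : ℕ => ‖((k : ℂ) + 1) * a (k + 1)‖ * R ^ k := by
  have h := (summable_nat_add_iff 1).mpr (ha (2 * (|R| + 1)))
  refine Summable.of_norm_bounded h fun k => ?_
  rw [norm_mul, norm_norm, norm_mul, norm_pow, Real.norm_eq_abs, mul_pow, mul_comm ‖(k : ℂ) + 1‖,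
    mul_assoc]
  have h1 : ‖(k : ℂ) + 1‖ ≤ 2 ^ (k + 1) := by
    have : ‖((k + 1 : ℕ) : ℂ)‖ ≤ 2 ^ (k + 1) := by
      rw [Complex.norm_natCast]
      exact_mod_cast (Nat.lt_two_pow_self (n := k + 1)).le
    simpa using this
  have h2 : |R| ^ k ≤ (|R| + 1) ^ (k + 1) :=
    (pow_le_pow_left₀ (abs_nonneg R) (by linarith) k).trans
      (pow_le_pow_right₀ (by linarith [abs_nonneg R]) (Nat.le_succ k))
  gcongr

/-- The coefficients of the entire function `z ↦ ∑ₖ aₖ zᵏ` with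
`J_ν(τ) = (τ/2)^ν ∑ₖ aₖ (τ/2)^(2k)`. -/
def besselCoeff (ν : ℂ) (k : ℕ) : ℂ :=
  (-1 : ℂ) ^ k / ((Nat.factorial k : ℂ) * Complex.Gamma (ν + k + 1))

theorem besselCoeff_succ (ν : ℂ) (k : ℕ) :
    ((k : ℂ) + 1) * (ν + k + 1) * besselCoeff ν (k + 1) = -besselCoeff ν k := by
  have h := Complex.one_div_Gamma_eq_self_mul_one_div_Gamma_add_one (ν + k + 1)
  have hk : (k : ℂ) + 1 ≠ 0 := by exact_mod_cast Nat.succ_ne_zero k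
  have hf : (Nat.factorial k : ℂ) ≠ 0 := by exact_mod_cast Nat.factorial_ne_zero k
  have e1 : besselCoeff ν k =
      (-1 : ℂ) ^ k / (Nat.factorial k : ℂ) * (Complex.Gamma (ν + k + 1))⁻¹ := by
    rw [besselCoeff, div_mul_eq_div_div, div_eq_mul_inv _ (Complex.Gamma _)]
  have e2 : besselCoeff ν (k + 1) = (-1 : ℂ) ^ (k + 1) / (((k : ℂ) + 1) * (Nat.factorial k : ℂ)) *
      (Complex.Gamma (ν + k + 1 + 1))⁻¹ := by
    rw [besselCoeff, div_mul_eq_div_div, div_eq_mul_inv _ (Complex.Gamma _), Nat.factorial_succ]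
    push_cast
    rw [add_assoc ν (k : ℂ) 1]
  rw [e1, e2, h]
  field_simp
  ring

theorem summable_besselCoeff (ν : ℂ) (R : ℝ) :
    Summable fun k => ‖besselCoeff ν k‖ * R ^ k := by
  obtain ⟨N, hN⟩ := exists_nat_ge (‖ν‖ + 2 * |R| + 1)
  refine summable_of_ratio_norm_eventually_le (r := 1 / 2) (by norm_num) ?_
  filter_upwards [Filter.eventually_ge_atTop N] with k hk
  have hk' : ‖ν‖ + 2 * |R| + 1 ≤ (k : ℝ) := hN.trans (by exact_mod_cast hk)
  have h := congrArg norm (besselCoeff_succ ν k)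
  rw [norm_neg, norm_mul, norm_mul] at h
  have h1 : 1 ≤ ‖(k : ℂ) + 1‖ := by
    have : ‖((k + 1 : ℕ) : ℂ)‖ = (k : ℝ) + 1 := by
      rw [Complex.norm_natCast]; push_cast; ring
    push_cast at this
    rw [this]; simp
  have h2 : 2 * |R| ≤ ‖ν + k + 1‖ := by
    have e : ((k : ℂ)) = (ν + k + 1) - (ν + 1) := by ring
    have h3 : ‖(k : ℂ)‖ ≤ ‖ν + k + 1‖ + ‖ν + 1‖ := by
      conv_lhs => rw [e]
      exact norm_sub_le _ _
    have h4 : ‖ν + 1‖ ≤ ‖ν‖ + 1 := (norm_add_le _ _).trans (by simp)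
    rw [Complex.norm_natCast] at h3
    linarith
  rw [norm_mul, norm_mul, norm_norm, norm_norm, norm_pow, norm_pow, Real.norm_eq_abs, pow_succ,
    ← h]
  have h5 : 2 * |R| ≤ ‖(k : ℂ) + 1‖ * ‖ν + k + 1‖ := by
    nlinarith [norm_nonneg (ν + k + 1)]
  have h6 : 0 ≤ ‖besselCoeff ν (k + 1)‖ * |R| ^ k := by positivity
  nlinarith [mul_le_mul_of_nonneg_right h5 h6]

/-- The entire function `H` with `J_ν(τ) = (τ/2)^ν H((τ/2)²)`, together with its first two
derivatives and its differential equation. -/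
theorem exists_besselEntire (ν : ℂ) : ∃ H H' H'' : ℂ → ℂ,
    (∀ z, H z = ∑' k, besselCoeff ν k * z ^ k) ∧
    (∀ z, HasDerivAt H (H' z) z) ∧ (∀ z, HasDerivAt H' (H'' z) z) ∧
    ∀ z, z * H'' z + (ν + 1) * H' z + H z = 0 := by
  have s0 := summable_besselCoeff ν
  have s1 := summable_norm_deriv_coeff s0
  have s2 := summable_norm_deriv_coeff s1
  have hsum : ∀ {a : ℕ → ℂ}, (∀ R : ℝ, Summable fun k => ‖a k‖ * R ^ k) → ∀ z : ℂ,
      Summable fun k => a k * z ^ k := fun h z => Summable.of_norm (by simpa using h ‖z‖)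
  refine ⟨fun z => ∑' k : ℕ, besselCoeff ν k * z ^ k,
    fun z => ∑' k : ℕ, ((k : ℂ) + 1) * besselCoeff ν (k + 1) * z ^ k,
    fun z => ∑' k : ℕ, ((k : ℂ) + 1) * ((((k + 1 : ℕ) : ℂ) + 1) * besselCoeff ν (k + 1 + 1)) * z ^ k,
    fun z => rfl, hasDerivAt_tsum_pow s0, hasDerivAt_tsum_pow s1, fun z => ?_⟩
  have t1 := hsum s1 z
  have t0 := hsum s0 z
  have t2 := (hsum s2 z).mul_left z
  have hs : Summable fun k : ℕ => (k : ℂ) * (((k : ℂ) + 1) * besselCoeff ν (k + 1)) * z ^ k := by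
    rw [← summable_nat_add_iff 1]
    refine t2.congr fun k => ?_
    push_cast
    ring
  have e2 : z * ∑' k : ℕ, ((k : ℂ) + 1) * ((((k + 1 : ℕ) : ℂ) + 1) * besselCoeff ν (k + 1 + 1)) *
      z ^ k = ∑' k : ℕ, (k : ℂ) * (((k : ℂ) + 1) * besselCoeff ν (k + 1)) * z ^ k := by
    rw [← tsum_mul_left, hs.tsum_eq_zero_add]
    simp only [Nat.cast_zero, zero_mul, zero_add]
    refine tsum_congr fun k => ?_
    push_cast
    ring
  rw [e2, ← tsum_mul_left, ← hs.tsum_add (t1.mul_left _),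
    ← (hs.add (t1.mul_left _)).tsum_add t0]
  convert tsum_zero with k
  have := besselCoeff_succ ν k
  linear_combination z ^ k * this

theorem besselJ_eq (ν : ℂ) {τ : ℝ} (hτ : 0 < τ) :
    besselJ ν τ = ((τ : ℂ) / 2) ^ ν * ∑' k, besselCoeff ν k * (((τ : ℂ) / 2) ^ 2) ^ k := by
  have h0 : (τ : ℂ) / 2 ≠ 0 := by simpa using hτ.ne'
  rw [besselJ, ← tsum_mul_left]
  refine tsum_congr fun k => ?_
  rw [Complex.cpow_add _ _ h0, ← pow_mul]
  have : ((τ : ℂ) / 2) ^ (2 * (k : ℂ)) = ((τ : ℂ) / 2) ^ (2 * k) := by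
    rw [← Complex.cpow_natCast]; push_cast; rfl
  rw [this, besselCoeff]
  ring

/-- `u` solves `u'' + (r² + μ (1+s)⁻²) u = 0` on `(-1, ∞)`, with first derivative `u'`. -/
def SolvesMode (μ r : ℝ) (u u' : ℝ → ℂ) : Prop :=
  ∀ s, -1 < s → HasDerivAt u (u' s) s ∧
    HasDerivAt u' (-((r : ℂ) ^ 2 + μ / (1 + (s : ℂ)) ^ 2) * u s) s

theorem SolvesMode.linearCombination {μ r : ℝ} {u u' v v' : ℝ → ℂ} (hu : SolvesMode μ r u u')
    (hv : SolvesMode μ r v v') (a b : ℂ) :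
    SolvesMode μ r (fun s => a * u s + b * v s) (fun s => a * u' s + b * v' s) := by
  intro s hs
  refine ⟨((hu s hs).1.const_mul a).add ((hv s hs).1.const_mul b), ?_⟩
  exact (((hu s hs).2.const_mul a).add ((hv s hs).2.const_mul b)).congr_deriv (by ring)

theorem solvesMode_ePlus {μ r : ℝ} {ν : ℂ} (hr : 0 < r) (hν : ν ^ 2 = 1 / 4 - μ) :
    ∃ u', SolvesMode μ r (ePlus ν r) u' := by
  obtain ⟨H, H', H'', hH, dH, dH', ode⟩ := exists_besselEntire ν
  set c : ℂ := (r : ℂ) / 2 with hc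
  have hc0 : c ≠ 0 := by simp [hc, hr.ne']
  set α : ℂ := ν + 1 / 2 with hα
  let z : ℝ → ℂ := fun s => c * (1 + s)
  have hz0 : ∀ s : ℝ, -1 < s → z s ∈ Complex.slitPlane := by
    intro s hs
    have : z s = ((r / 2 * (1 + s) : ℝ) : ℂ) := by simp [z, hc]
    rw [this]
    exact Complex.ofReal_mem_slitPlane.mpr (mul_pos (by positivity) (by linarith))
  have dz : ∀ s, HasDerivAt z c s := by
    intro s
    have := (((hasDerivAt_id s).ofReal_comp).const_add (1 : ℂ)).const_mul c
    simpa using this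
  have dp : ∀ s : ℝ, -1 < s → ∀ γ : ℂ,
      HasDerivAt (fun s => z s ^ γ) (γ * z s ^ γ / z s * c) s := by
    intro s hs γ
    have hne := Complex.slitPlane_ne_zero (hz0 s hs)
    have h := (((hasDerivAt_id (z s)).cpow_const (c := γ) (hz0 s hs)).comp s (dz s))
    refine h.congr_deriv ?_
    rw [id]
    rw [Complex.cpow_sub _ _ hne, Complex.cpow_one]
    ring
  have dsq : ∀ s, HasDerivAt (fun s => z s ^ 2) (2 * z s * c) s := by
    intro s
    exact ((dz s).fun_pow 2).congr_deriv (by simp)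
  have dHs : ∀ s, HasDerivAt (fun s => H (z s ^ 2)) (H' (z s ^ 2) * (2 * z s * c)) s :=
    fun s => (dH _).comp s (dsq s)
  have dHs' : ∀ s, HasDerivAt (fun s => H' (z s ^ 2)) (H'' (z s ^ 2) * (2 * z s * c)) s :=
    fun s => (dH' _).comp s (dsq s)
  have heq : ∀ s : ℝ, -1 < s →
      ePlus ν r s = (Real.sqrt 2 : ℂ) * (z s ^ α * H (z s ^ 2)) := by
    intro s hs
    have hx : 0 < (1 + s) * r := mul_pos (by linarith) hr
    have hzs : (((1 + s) * r : ℝ) : ℂ) / 2 = z s := by simp only [z, hc]; push_cast; ring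
    have hsq : (Real.sqrt ((1 + s) * r) : ℂ) = (Real.sqrt 2 : ℂ) * z s ^ (1 / 2 : ℂ) := by
      have h1 : (1 + s) * r = 2 * ((1 + s) * r / 2) := by ring
      rw [← hzs]
      conv_lhs => rw [h1, Real.sqrt_mul (by norm_num), Complex.ofReal_mul,
        Real.sqrt_eq_rpow ((1 + s) * r / 2), Complex.ofReal_cpow (by positivity)]
      push_cast
      rfl
    rw [ePlus, besselJ_eq ν hx, hzs, ← hH, hsq, hα,
      Complex.cpow_add _ _ (Complex.slitPlane_ne_zero (hz0 s hs))]
    ring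
  refine ⟨fun s => (Real.sqrt 2 : ℂ) * (α * z s ^ α / z s * c * H (z s ^ 2) +
    z s ^ α * (H' (z s ^ 2) * (2 * z s * c))), fun s hs => ?_⟩
  have hne := Complex.slitPlane_ne_zero (hz0 s hs)
  constructor
  · refine (((dp s hs α).mul (dHs s)).const_mul _).congr_of_eventuallyEq ?_
    filter_upwards [lt_mem_nhds hs] with t ht using heq t ht
  · have d1 : HasDerivAt (fun s => α * z s ^ α / z s * c)
        ((α * (α * z s ^ α / z s * c) * z s - α * z s ^ α * c) / z s ^ 2 * c) s :=
      (((dp s hs α).const_mul α).div (dz s) hne).mul_const c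
    have d2 := (d1.mul (dHs s)).add
      ((dp s hs α).mul ((dHs' s).mul (((dz s).const_mul 2).mul_const c)))
    have d3 := d2.const_mul (Real.sqrt 2 : ℂ)
    refine d3.congr_deriv ?_
    simp only [Pi.mul_apply]
    rw [heq s hs]
    have hs1 : (1 + (s : ℂ)) ≠ 0 := by
      intro h
      apply hne
      simp [z, h]
    have hodes := ode (z s ^ 2)
    have hr' : (r : ℂ) = 2 * c := by rw [hc]; ring
    have hμ' : (μ : ℂ) = 1 / 4 - ν ^ 2 := by rw [hν]; ring
    have hx : (1 + (s : ℂ)) = z s / c := by simp only [z]; field_simp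
    rw [hx, hr', hμ']
    generalize z s = w at *
    generalize w ^ α = p at *
    rw [hα]
    field_simp
    linear_combination (64 * p * w ^ 2) * hodes

theorem solvesMode_eMinus {μ r : ℝ} {ν : ℂ} (hr : 0 < r) (hν : ν ^ 2 = 1 / 4 - μ) :
    ∃ u', SolvesMode μ r (eMinus ν r) u' := by
  obtain ⟨u', hu⟩ := solvesMode_ePlus hr hν
  obtain ⟨v', hv⟩ := solvesMode_ePlus (ν := -ν) hr (by rw [neg_sq, hν])
  have h := hu.linearCombination hv (Complex.cos (ν * (π : ℂ)) / Complex.sin (ν * (π : ℂ)))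
    (-1 / Complex.sin (ν * (π : ℂ)))
  have e : eMinus ν r = fun s => Complex.cos (ν * (π : ℂ)) / Complex.sin (ν * (π : ℂ)) *
      ePlus ν r s + -1 / Complex.sin (ν * (π : ℂ)) * ePlus (-ν) r s := by
    funext s
    rw [eMinus, besselY, ePlus, ePlus]
    ring
  exact ⟨_, e ▸ h⟩

theorem nuOf_sq (μ : ℝ) : nuOf μ ^ 2 = 1 / 4 - μ := by
  unfold nuOf
  split_ifs with h
  · rw [← Complex.ofReal_pow, div_pow, Real.sq_sqrt (by linarith)]
    push_cast
    ring
  · rw [mul_pow, Complex.I_sq, ← Complex.ofReal_pow, div_pow, Real.sq_sqrt (by linarith)]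
    push_cast
    ring

/-- A Sonine–Pólya type estimate: after the substitution `u = x^β w`, `x = 1 + s = e^y`, the mode
equation becomes `w'' + (2β-1) w' + q w = 0` with `q` increasing and bounded below by
`μ - β(1-β) > 0`, so `|w'|²/q + |w|²` is nonincreasing. -/
theorem SolvesMode.norm_le {μ r β t₀ s : ℝ} {u u' : ℝ → ℂ} (h : SolvesMode μ r u u')
    (hβ : 1 / 2 ≤ β) (hβ1 : β < 1) (hβμ : β * (1 - β) < μ) (ht₀ : 0 ≤ t₀) (hs : t₀ ≤ s) :
    ‖u s‖ ≤ (1 + s) ^ β * ((1 + t₀) ^ (1 - β) *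
      ((1 + 1 / √(μ - β * (1 - β))) * (‖u t₀‖ + ‖u' t₀‖))) := by
  set κ : ℝ := μ - β * (1 - β) with hκ
  have hκ0 : 0 < κ := by linarith
  let q : ℝ → ℝ := fun s => r ^ 2 * (1 + s) ^ 2 + κ
  have hqκ : ∀ s, κ ≤ q s := fun s => by
    have : 0 ≤ r ^ 2 * (1 + s) ^ 2 := by positivity
    simp only [q]; linarith
  have hq0 : ∀ s, 0 < q s := fun s => hκ0.trans_le (hqκ s)
  let v : ℝ → ℂ := fun s => (1 + (s : ℂ)) * u' s - β * u s
  let G : ℝ → ℝ := fun s => (1 + s) ^ (-(2 * β)) * (‖v s‖ ^ 2 / q s + ‖u s‖ ^ 2)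
  have dx : ∀ s : ℝ, HasDerivAt (fun s : ℝ => 1 + s) 1 s := fun s =>
    (hasDerivAt_id s).const_add 1
  have dG : ∀ s, -1 < s → HasDerivAt G ((1 + s) ^ (-(2 * β)) / (1 + s) *
      (2 * (1 - 2 * β) * (‖v s‖ ^ 2 / q s) -
        2 * r ^ 2 * (1 + s) ^ 2 * ‖v s‖ ^ 2 / q s ^ 2)) s := by
    intro s hs
    have hx : 0 < 1 + s := by linarith
    have hxc : (1 + (s : ℂ)) ≠ 0 := by exact_mod_cast hx.ne'
    have du : HasDerivAt u (((1 + s)⁻¹ : ℝ) • (v s + β • u s)) s := by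
      refine (h s hs).1.congr_deriv ?_
      simp only [v, Complex.real_smul]
      push_cast
      field_simp
      ring
    have dv : HasDerivAt v (((1 + s)⁻¹ : ℝ) • ((1 - β) • v s - q s • u s)) s := by
      have dxc : HasDerivAt (fun s : ℝ => (1 + (s : ℂ))) 1 s := by
        simpa using ((hasDerivAt_id s).ofReal_comp).const_add (1 : ℂ)
      refine ((dxc.mul (h s hs).2).sub ((h s hs).1.const_mul (β : ℂ))).congr_deriv ?_
      simp only [v, q, hκ, Complex.real_smul]
      push_cast
      field_simp
      ring
    have dA := du.norm_sq
    have dB := dv.norm_sq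
    have dq : HasDerivAt q (r ^ 2 * (2 * (1 + s))) s := by
      refine ((((dx s).fun_pow 2).const_mul (r ^ 2)).add_const κ).congr_deriv ?_
      simp
    have dp : HasDerivAt (fun s : ℝ => (1 + s) ^ (-(2 * β)))
        (-(2 * β) * ((1 + s) ^ (-(2 * β)) / (1 + s))) s := by
      refine ((dx s).rpow_const (p := -(2 * β)) (Or.inl hx.ne')).congr_deriv ?_
      rw [Real.rpow_sub_one hx.ne']
      ring
    refine (dp.mul ((dB.div dq (hq0 s).ne').add dA)).congr_deriv ?_
    have hq := (hq0 s).ne'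
    simp only [Pi.add_apply, Pi.div_apply, inner_smul_right, inner_add_right, inner_sub_right,
      real_inner_self_eq_norm_sq, real_inner_comm (u s) (v s)]
    generalize q s = Q at *
    generalize (1 + s) ^ (-(2 * β)) = p at *
    generalize inner ℝ (u s) (v s) = I at *
    field_simp
    ring
  have hanti : AntitoneOn G (Set.Ici t₀) := by
    refine antitoneOn_of_hasDerivWithinAt_nonpos (convex_Ici t₀)
      (fun x hx => (dG x (by linarith [Set.mem_Ici.mp hx])).continuousAt.continuousWithinAt)
      (fun x hx => (dG x ?_).hasDerivWithinAt) (fun x hx => ?_)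
    · rw [interior_Ici] at hx
      linarith [Set.mem_Ioi.mp hx]
    · rw [interior_Ici] at hx
      have hx' : 0 < 1 + x := by linarith [Set.mem_Ioi.mp hx]
      have hq := hq0 x
      have h1 : 0 ≤ (2 * β - 1) * (‖v x‖ ^ 2 / q x) := mul_nonneg (by linarith) (by positivity)
      have h2 : 0 ≤ 2 * r ^ 2 * (1 + x) ^ 2 * ‖v x‖ ^ 2 / q x ^ 2 := by positivity
      exact mul_nonpos_of_nonneg_of_nonpos (by positivity) (by linarith)
  have hG := hanti (Set.mem_Ici.mpr le_rfl) (Set.mem_Ici.mpr hs) hs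
  have ha : 0 < 1 + t₀ := by linarith
  have hx : 0 < 1 + s := by linarith
  have hsq : ∀ {y : ℝ}, 0 < y → y ^ (-(2 * β)) = (y ^ (-β)) ^ 2 := fun {y} hy => by
    rw [← Real.rpow_natCast, ← Real.rpow_mul hy.le]
    congr 1
    push_cast
    ring
  set M : ℝ := ‖v t₀‖ / √κ + ‖u t₀‖ with hM
  have hsκ : 0 < √κ := Real.sqrt_pos.mpr hκ0
  have hle : ((1 + s) ^ (-β) * ‖u s‖) ^ 2 ≤ ((1 + t₀) ^ (-β) * M) ^ 2 := by
    rw [mul_pow, mul_pow, ← hsq hx, ← hsq ha]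
    have e1 : (1 + s) ^ (-(2 * β)) * ‖u s‖ ^ 2 ≤ G s := by
      have := hq0 s
      exact mul_le_mul_of_nonneg_left (le_add_of_nonneg_left (by positivity)) (by positivity)
    have e2 : G t₀ ≤ (1 + t₀) ^ (-(2 * β)) * M ^ 2 := by
      refine mul_le_mul_of_nonneg_left ?_ (by positivity)
      have e3 : ‖v t₀‖ ^ 2 / q t₀ ≤ (‖v t₀‖ / √κ) ^ 2 := by
        rw [div_pow, Real.sq_sqrt hκ0.le]
        exact div_le_div_of_nonneg_left (by positivity) hκ0 (hqκ t₀)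
      have e4 : 0 ≤ ‖v t₀‖ / √κ * ‖u t₀‖ := by positivity
      rw [hM]
      nlinarith
    exact e1.trans (hG.trans e2)
  have hM0 : 0 ≤ M := by positivity
  have hle' : (1 + s) ^ (-β) * ‖u s‖ ≤ (1 + t₀) ^ (-β) * M :=
    (pow_le_pow_iff_left₀ (by positivity) (by positivity) two_ne_zero).1 hle
  set S : ℝ := ‖u t₀‖ + ‖u' t₀‖ with hS
  have hv : ‖v t₀‖ ≤ (1 + t₀) * S := by
    have h1 : ‖(1 + (t₀ : ℂ))‖ = 1 + t₀ := by
      rw [← Complex.ofReal_one, ← Complex.ofReal_add, Complex.norm_real, Real.norm_of_nonneg ha.le]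
    have h2 : ‖(β : ℂ)‖ = β := by rw [Complex.norm_real, Real.norm_of_nonneg (by linarith)]
    have h3 := norm_sub_le ((1 + (t₀ : ℂ)) * u' t₀) (β * u t₀)
    rw [norm_mul, norm_mul, h1, h2] at h3
    refine h3.trans ?_
    have h4 : β * ‖u t₀‖ ≤ (1 + t₀) * ‖u t₀‖ :=
      mul_le_mul_of_nonneg_right (by linarith) (norm_nonneg _)
    rw [hS]
    linarith
  have hu : ‖u t₀‖ ≤ (1 + t₀) * S := by
    rw [hS]
    nlinarith [norm_nonneg (u t₀), norm_nonneg (u' t₀)]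
  have hMS : M ≤ (1 + t₀) * ((1 + 1 / √κ) * S) := by
    calc M ≤ (1 + t₀) * S / √κ + (1 + t₀) * S := by rw [hM]; gcongr
      _ = _ := by ring
  calc ‖u s‖ = (1 + s) ^ β * ((1 + s) ^ (-β) * ‖u s‖) := by
        rw [← mul_assoc, ← Real.rpow_add hx, add_neg_cancel, Real.rpow_zero, one_mul]
    _ ≤ (1 + s) ^ β * ((1 + t₀) ^ (-β) * ((1 + t₀) * ((1 + 1 / √κ) * S))) := by
        exact mul_le_mul_of_nonneg_left
          (hle'.trans (mul_le_mul_of_nonneg_left hMS (by positivity))) (by positivity)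
    _ = _ := by
        rw [← mul_assoc ((1 + t₀) ^ (-β)), ← Real.rpow_add_one ha.ne', neg_add_eq_sub]

theorem norm_propagator_le {μ r β t₀ s : ℝ} (hr : 0 < r) (hβ : 1 / 2 ≤ β) (hβ1 : β < 1)
    (hβμ : β * (1 - β) < μ) (ht₀ : 0 ≤ t₀) (hs : t₀ ≤ s) (a b : ℂ) :
    ‖E0 (nuOf μ) r s t₀ * a + E1 (nuOf μ) r s t₀ * b‖ ≤
      (1 + s) ^ β * ((1 + t₀) ^ (1 - β) * ((1 + 1 / √(μ - β * (1 - β))) * (‖a‖ + ‖b‖))) := by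
  obtain ⟨p', hp⟩ := solvesMode_ePlus hr (nuOf_sq μ)
  obtain ⟨m', hm⟩ := solvesMode_eMinus hr (nuOf_sq μ)
  have hpd : ePlusDot (nuOf μ) r t₀ = p' t₀ := (hp t₀ (by linarith)).1.deriv
  have hmd : eMinusDot (nuOf μ) r t₀ = m' t₀ := (hm t₀ (by linarith)).1.deriv
  set p := ePlus (nuOf μ) r
  set m := eMinus (nuOf μ) r
  have hs0 : 0 < 1 + s := by linarith
  by_cases hW : p t₀ * m' t₀ - p' t₀ * m t₀ = 0
  · have e0 : E0 (nuOf μ) r s t₀ = 0 := by rw [E0, hpd, hmd, hW, div_zero]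
    have e1 : E1 (nuOf μ) r s t₀ = 0 := by rw [E1, hpd, hmd, hW, div_zero]
    rw [e0, e1, zero_mul, zero_mul, zero_add, norm_zero]
    positivity
  · have h := (hp.linearCombination hm ((a * m' t₀ - b * m t₀) / (p t₀ * m' t₀ - p' t₀ * m t₀))
      ((b * p t₀ - a * p' t₀) / (p t₀ * m' t₀ - p' t₀ * m t₀))).norm_le hβ hβ1 hβμ ht₀ hs
    have e0 : (a * m' t₀ - b * m t₀) / (p t₀ * m' t₀ - p' t₀ * m t₀) * p t₀ +
        (b * p t₀ - a * p' t₀) / (p t₀ * m' t₀ - p' t₀ * m t₀) * m t₀ = a := by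
      rw [div_mul_eq_mul_div, div_mul_eq_mul_div, ← add_div, div_eq_iff hW]
      ring
    have e1 : (a * m' t₀ - b * m t₀) / (p t₀ * m' t₀ - p' t₀ * m t₀) * p' t₀ +
        (b * p t₀ - a * p' t₀) / (p t₀ * m' t₀ - p' t₀ * m t₀) * m' t₀ = b := by
      rw [div_mul_eq_mul_div, div_mul_eq_mul_div, ← add_div, div_eq_iff hW]
      ring
    have es : E0 (nuOf μ) r s t₀ * a + E1 (nuOf μ) r s t₀ * b =
        (a * m' t₀ - b * m t₀) / (p t₀ * m' t₀ - p' t₀ * m t₀) * p s +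
        (b * p t₀ - a * p' t₀) / (p t₀ * m' t₀ - p' t₀ * m t₀) * m s := by
      rw [E0, E1, hpd, hmd]
      ring
    simp only [e0, e1] at h
    rwa [es]

theorem lintegral_Ioi_one_add_rpow {β t₀ : ℝ} (hβ1 : β < 1) (ht₀ : 0 ≤ t₀) :
    ∫⁻ s in Set.Ioi t₀, ENNReal.ofReal ((1 + s) ^ (β - 2)) =
      ENNReal.ofReal ((1 + t₀) ^ (β - 1) / (1 - β)) := by
  have hi : IntegrableOn (fun s : ℝ => (1 + s) ^ (β - 2)) (Set.Ioi t₀) := by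
    simpa only [add_comm] using
      integrableOn_add_rpow_Ioi_of_lt (a := β - 2) (m := 1) (c := t₀) (by linarith) (by linarith)
  rw [← ofReal_integral_eq_lintegral_ofReal hi]
  · have h1 := (measurePreserving_add_left volume (1 : ℝ)).setIntegral_preimage_emb
      (measurableEmbedding_addLeft 1) (fun x : ℝ => x ^ (β - 2)) (Set.Ioi (1 + t₀))
    rw [Set.preimage_const_add_Ioi, add_sub_cancel_left,
      integral_Ioi_rpow_of_lt (by linarith) (by linarith)] at h1
    rw [h1, show β - 2 + 1 = β - 1 by ring, ← neg_sub 1 β, neg_div_neg_eq]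
  · filter_upwards [ae_restrict_mem measurableSet_Ioi] with s hs
    have : 0 < 1 + s := by linarith [Set.mem_Ioi.mp hs]
    positivity

/-- key integrability estimate: for `μ > 0`, `μ ≠ 1/4`,
`∫_{t₀}^∞ (1+s)^{-2} ‖E₀(s,t₀,·)g₀ + E₁(s,t₀,·)g₁‖_{L²} ds ≤ C(‖g₀‖_{L²}+‖g₁‖_{L²})`
uniformly in `t₀ ≥ 0`. -/
theorem stmt15 (μ : ℝ) (hμ : 0 < μ) (hμ' : μ ≠ 1 / 4) (d : ℕ) (hd : 1 ≤ d) :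
    ∃ C > (0 : ℝ), ∀ t₀ : ℝ, 0 ≤ t₀ →
      ∀ g₀ g₁ : EuclideanSpace ℝ (Fin d) → ℂ, Measurable g₀ → Measurable g₁ →
        eLpNorm g₀ 2 volume < ⊤ → eLpNorm g₁ 2 volume < ⊤ →
        (∫⁻ s in Set.Ioi t₀, ENNReal.ofReal ((1 + s) ^ (-(2 : ℝ))) *
            eLpNorm (fun ξ => E0 (nuOf μ) ‖ξ‖ s t₀ * g₀ ξ + E1 (nuOf μ) ‖ξ‖ s t₀ * g₁ ξ)
              2 volume) ≤
          ENNReal.ofReal C * (eLpNorm g₀ 2 volume + eLpNorm g₁ 2 volume) := by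
  obtain ⟨β, hβ, hβ1, hβμ⟩ : ∃ β : ℝ, 1 / 2 ≤ β ∧ β < 1 ∧ β * (1 - β) < μ := by
    refine ⟨max (1 / 2) (1 - μ / 2), le_max_left _ _, max_lt (by norm_num) (by linarith), ?_⟩
    have h1 := le_max_left (1 / 2 : ℝ) (1 - μ / 2)
    have h2 := le_max_right (1 / 2 : ℝ) (1 - μ / 2)
    have h3 : max (1 / 2 : ℝ) (1 - μ / 2) < 1 := max_lt (by norm_num) (by linarith)
    nlinarith
  set K : ℝ := 1 + 1 / √(μ - β * (1 - β)) with hK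
  have hK0 : 0 < K := by positivity
  have hβ' : 0 < 1 - β := by linarith
  refine ⟨K / (1 - β), by positivity, fun t₀ ht₀ g₀ g₁ hg₀ hg₁ _ _ => ?_⟩
  have ha : 0 < 1 + t₀ := by linarith
  have : Nonempty (Fin d) := ⟨⟨0, hd⟩⟩
  set A : ℝ := (1 + t₀) ^ (1 - β) * K with hA
  have hA0 : 0 ≤ A := by positivity
  set N := eLpNorm g₀ 2 volume + eLpNorm g₁ 2 volume with hN
  have hmode : ∀ s ∈ Set.Ioi t₀, eLpNorm (fun ξ : EuclideanSpace ℝ (Fin d) =>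
      E0 (nuOf μ) ‖ξ‖ s t₀ * g₀ ξ + E1 (nuOf μ) ‖ξ‖ s t₀ * g₁ ξ) 2 volume ≤
      ENNReal.ofReal ((1 + s) ^ β * A) * N := by
    intro s hs
    have hs' : t₀ ≤ s := (Set.mem_Ioi.mp hs).le
    calc _ ≤ ENNReal.ofReal ((1 + s) ^ β * A) *
          eLpNorm ((fun ξ => ‖g₀ ξ‖) + fun ξ => ‖g₁ ξ‖) 2 volume := by
          refine eLpNorm_le_mul_eLpNorm_of_ae_le_mul ?_ 2
          filter_upwards [Measure.ae_ne volume (0 : EuclideanSpace ℝ (Fin d))] with ξ hξ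
          refine (norm_propagator_le (norm_pos_iff.mpr hξ) hβ hβ1 hβμ ht₀ hs' _ _).trans ?_
          rw [Pi.add_apply, Real.norm_of_nonneg (by positivity), hA, mul_assoc, mul_assoc]
      _ ≤ _ := by
          gcongr
          refine (eLpNorm_add_le hg₀.norm.aestronglyMeasurable hg₁.norm.aestronglyMeasurable
            one_le_two).trans ?_
          rw [eLpNorm_norm, eLpNorm_norm]
  calc _ ≤ ∫⁻ s in Set.Ioi t₀, ENNReal.ofReal ((1 + s) ^ (β - 2)) * (ENNReal.ofReal A * N) := by
        refine setLIntegral_mono' measurableSet_Ioi fun s hs => ?_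
        have hs0 : 0 < 1 + s := by linarith [Set.mem_Ioi.mp hs]
        have h1 : (1 + s) ^ (-(2 : ℝ)) * ((1 + s) ^ β * A) = (1 + s) ^ (β - 2) * A := by
          rw [← mul_assoc, ← Real.rpow_add hs0, neg_add_eq_sub]
        refine (mul_le_mul_right (hmode s hs) _).trans_eq ?_
        rw [← mul_assoc, ← ENNReal.ofReal_mul (by positivity), h1,
          ENNReal.ofReal_mul (by positivity), mul_assoc]
    _ = ENNReal.ofReal (K / (1 - β)) * N := by
        rw [lintegral_mul_const _ (by fun_prop), lintegral_Ioi_one_add_rpow hβ1 ht₀, ← mul_assoc,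
          ← ENNReal.ofReal_mul (by positivity)]
        congr 2
        have h1 : (1 + t₀) ^ (β - 1) * (1 + t₀) ^ (1 - β) = 1 := by
          rw [← Real.rpow_add ha, sub_add_sub_cancel, sub_self, Real.rpow_zero]
        rw [hA]
        linear_combination K / (1 - β) * h1

end
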